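/- arXiv:1202.0524 — 2 statements merged into one kernel-verified Lean document; each statement's English description precedes it below -/
import Mathlib

section
/- Every lattice polygon P ⊆ ℝ² admits a smallest maximal decomposition Z that is equivalent under an affine unimodular transformation of ℤ² to n₁[0,e₁] + n₂[0,e₂] + n₃[0, e₁+e₂] for some nonnegative integers n₁, n₂, n₃ with n₁+n₂+n₃ = L(P). -/
open Pointwise

/-- The real point corresponding to a lattice point. -/
def coeV {n : ℕ} (v : Fin n → ℤ) : Fin n → ℝ := fun i => (v i : ℝ)

/-- A vector in `ℤ^n` is primitive if the gcd of its coordinates is `1`. -/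
def IsPrim {n : ℕ} (v : Fin n → ℤ) : Prop := Finset.univ.gcd v = 1

/-- The zonotope with base lattice point `A` obtained as the Minkowski sum of the
lattice segments `[0, v i]`. -/
def Zono {n L : ℕ} (A : Fin n → ℤ) (v : Fin L → Fin n → ℤ) : Set (Fin n → ℝ) :=
  ({coeV A} : Set (Fin n → ℝ)) + ∑ i, segment ℝ 0 (coeV (v i))

/-- `P` contains (a translate of) a Minkowski sum of `L` primitive lattice segments. -/
def IsDecomp {n : ℕ} (P : Set (Fin n → ℝ)) (L : ℕ) : Prop :=
  ∃ (A : Fin n → ℤ) (v : Fin L → Fin n → ℤ), (∀ i, IsPrim (v i)) ∧ Zono A v ⊆ P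

/-- `L` is the Minkowski length of `P`. -/
def MinkLen {n : ℕ} (P : Set (Fin n → ℝ)) (L : ℕ) : Prop :=
  IsDecomp P L ∧ ∀ M, IsDecomp P M → M ≤ L

/-- `P` is a lattice polytope: the convex hull of a nonempty finite set of lattice points. -/
def IsLatticePolytope {n : ℕ} (P : Set (Fin n → ℝ)) : Prop :=
  ∃ S : Finset (Fin n → ℤ), S.Nonempty ∧ P = convexHull ℝ (coeV '' ↑S)

/-- `Zono A v` is a smallest maximal Minkowski decomposition in `P`: it realizes the
Minkowski length of `P` and is minimal with respect to inclusion among all maximal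
decompositions in `P`. -/
def IsSmallestMax {n L : ℕ} (P : Set (Fin n → ℝ)) (A : Fin n → ℤ)
    (v : Fin L → Fin n → ℤ) : Prop :=
  (∀ i, IsPrim (v i)) ∧ Zono A v ⊆ P ∧ MinkLen P L ∧
    ∀ (B : Fin n → ℤ) (w : Fin L → Fin n → ℤ), (∀ i, IsPrim (w i)) →
      Zono B w ⊆ P → Zono B w ⊆ Zono A v → Zono B w = Zono A v

/-- The determinant of the pair of planar integer vectors `v`, `w`. -/
def det₂ (v w : Fin 2 → ℤ) : ℤ := v 0 * w 1 - v 1 * w 0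

theorem isPrim_iff_isCoprime (v : Fin 2 → ℤ) : IsPrim v ↔ IsCoprime (v 0) (v 1) := by
  have h : (Finset.univ : Finset (Fin 2)) = {0, 1} := by decide
  rw [IsPrim, h, Finset.gcd_insert, Finset.gcd_singleton, Int.isCoprime_iff_gcd_eq_one,
    ← Int.coe_gcd, ← Int.abs_eq_normalize, Int.gcd, Int.natAbs_abs]
  exact_mod_cast Iff.rfl

theorem exists_eq_smul_isPrim {m : Fin 2 → ℤ} (hm : m ≠ 0) :
    ∃ (g : ℤ) (u : Fin 2 → ℤ), 1 ≤ g ∧ IsPrim u ∧ m = g • u := by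
  have hg : 0 < Int.gcd (m 0) (m 1) := by
    rw [Int.gcd_pos_iff]
    by_contra! h
    exact hm (funext fun i => by fin_cases i <;> simp [h.1, h.2])
  obtain ⟨a, ha⟩ := Int.gcd_dvd_left (m 0) (m 1)
  obtain ⟨b, hb⟩ := Int.gcd_dvd_right (m 0) (m 1)
  refine ⟨Int.gcd (m 0) (m 1), ![a, b], by exact_mod_cast hg, ?_, ?_⟩
  · rw [isPrim_iff_isCoprime, Int.isCoprime_iff_gcd_eq_one]
    have h := Int.gcd_div_gcd_div_gcd hg
    have hne : (Int.gcd (m 0) (m 1) : ℤ) ≠ 0 := by exact_mod_cast hg.ne'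
    rw [Int.ediv_eq_of_eq_mul_right hne ha, Int.ediv_eq_of_eq_mul_right hne hb] at h
    simpa using h
  · funext i
    fin_cases i
    · simpa using ha
    · simpa using hb

theorem mem_zono {n L : ℕ} {A : Fin n → ℤ} {v : Fin L → Fin n → ℤ} {x : Fin n → ℝ} :
    x ∈ Zono A v ↔ ∃ t : Fin L → ℝ, (∀ i, t i ∈ Set.Icc (0 : ℝ) 1) ∧
      x = coeV A + ∑ i, t i • coeV (v i) := by
  simp only [Zono, Set.mem_add, Set.mem_singleton_iff, exists_eq_left, Set.mem_finsetSum]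
  constructor
  · rintro ⟨y, ⟨g, hg, rfl⟩, rfl⟩
    have h : ∀ i, ∃ t : ℝ, t ∈ Set.Icc (0 : ℝ) 1 ∧ t • coeV (v i) = g i := fun i => by
      have := hg (Finset.mem_univ i)
      rw [segment_eq_image] at this
      simpa using this
    choose t ht hgt using h
    exact ⟨t, ht, by simp [hgt]⟩
  · rintro ⟨t, ht, rfl⟩
    refine ⟨_, ⟨fun i => t i • coeV (v i), fun {i} _ => ?_, rfl⟩, rfl⟩
    rw [segment_eq_image]
    exact ⟨t i, ht i, by simp⟩

theorem convex_zono {n L : ℕ} (A : Fin n → ℤ) (v : Fin L → Fin n → ℤ) : Convex ℝ (Zono A v) :=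
  (convex_singleton _).add (convex_sum _ fun _ _ => convex_segment _ _)

theorem zono_subset_of_preimage_subset {n L : ℕ} {A : Fin n → ℤ} {v : Fin L → Fin n → ℤ}
    {s : Set (Fin n → ℝ)} (hs : Convex ℝ s) (h : coeV ⁻¹' Zono A v ⊆ coeV ⁻¹' s) :
    Zono A v ⊆ s := by
  have hz : Zono A v = convexHull ℝ ({coeV A} + ∑ i, {0, coeV (v i)}) := by
    rw [convexHull_add, convexHull_sum, convexHull_singleton]
    simp only [convexHull_pair, Zono]
  have hsub : ({coeV A} + ∑ i, {0, coeV (v i)} : Set (Fin n → ℝ)) ⊆ Zono A v :=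
    hz ▸ subset_convexHull ℝ _
  rw [hz]
  refine convexHull_min (fun x hx => ?_) hs
  suffices ∃ y : Fin n → ℤ, x = coeV y by
    obtain ⟨y, rfl⟩ := this
    exact h (hsub hx)
  simp only [Set.mem_add, Set.mem_singleton_iff, exists_eq_left, Set.mem_finsetSum] at hx
  obtain ⟨_, ⟨g, hg, rfl⟩, rfl⟩ := hx
  have hl : ∀ i, ∃ y : Fin n → ℤ, g i = coeV y := fun i => by
    rcases hg (Finset.mem_univ i) with h0 | h1
    · exact ⟨0, by rw [h0]; ext; simp [coeV]⟩
    · exact ⟨v i, h1⟩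
  choose y hy using hl
  refine ⟨A + ∑ i, y i, ?_⟩
  ext k
  simp [hy, coeV]

/-- The width of a zonotope in any direction is monotone under inclusion. -/
theorem sum_abs_le_of_zono_subset {n L K : ℕ} {A B : Fin n → ℤ} {v : Fin L → Fin n → ℤ}
    {w : Fin K → Fin n → ℤ} (h : Zono B w ⊆ Zono A v) (φ : (Fin n → ℝ) →ₗ[ℝ] ℝ) :
    ∑ i, |φ (coeV (w i))| ≤ ∑ i, |φ (coeV (v i))| := by
  have hp : coeV B + ∑ i, (if 0 ≤ φ (coeV (w i)) then (1 : ℝ) else 0) • coeV (w i) ∈ Zono B w :=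
    mem_zono.2 ⟨_, fun i => by split_ifs <;> simp, rfl⟩
  have hq : coeV B + ∑ i, (if 0 ≤ φ (coeV (w i)) then (0 : ℝ) else 1) • coeV (w i) ∈ Zono B w :=
    mem_zono.2 ⟨_, fun i => by split_ifs <;> simp, rfl⟩
  obtain ⟨t, ht, hpt⟩ := mem_zono.1 (h hp)
  obtain ⟨s, hs, hqs⟩ := mem_zono.1 (h hq)
  have e1 := congrArg φ hpt
  have e2 := congrArg φ hqs
  simp only [map_add, map_sum, map_smul, smul_eq_mul] at e1 e2
  calc ∑ i, |φ (coeV (w i))|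
      = ∑ i, ((if 0 ≤ φ (coeV (w i)) then (1 : ℝ) else 0) * φ (coeV (w i))
          - (if 0 ≤ φ (coeV (w i)) then (0 : ℝ) else 1) * φ (coeV (w i))) := by
        refine Finset.sum_congr rfl fun i _ => ?_
        split_ifs with h0
        · rw [abs_of_nonneg h0]; ring
        · rw [abs_of_neg (not_le.1 h0)]; ring
    _ = ∑ i, (t i - s i) * φ (coeV (v i)) := by
        simp only [sub_mul, Finset.sum_sub_distrib]
        linarith
    _ ≤ ∑ i, |φ (coeV (v i))| := by
        refine Finset.sum_le_sum fun i _ => ?_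
        calc (t i - s i) * φ (coeV (v i)) ≤ |t i - s i| * |φ (coeV (v i))| := by
              rw [← abs_mul]; exact le_abs_self _
          _ ≤ 1 * |φ (coeV (v i))| := by
              gcongr
              rw [abs_le]
              constructor <;> linarith [(ht i).1, (ht i).2, (hs i).1, (hs i).2]
          _ = _ := one_mul _

theorem finite_preimage_coeV {n : ℕ} {P : Set (Fin n → ℝ)} (hP : IsLatticePolytope P) :
    (coeV ⁻¹' P).Finite := by
  obtain ⟨S, -, rfl⟩ := hP
  obtain ⟨R, hR⟩ := ((S.finite_toSet.image coeV).isCompact_convexHull (𝕜 := ℝ)).isBounded.exists_norm_le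
  refine (Set.finite_Icc (fun _ : Fin n => -⌈R⌉) (fun _ => ⌈R⌉)).subset fun x hx => ?_
  have h : ∀ i, |(x i : ℝ)| ≤ ⌈R⌉ := fun i =>
    ((norm_le_pi_norm (coeV x) i).trans (hR _ hx)).trans (Int.le_ceil R)
  exact ⟨fun i => by exact_mod_cast (abs_le.1 (h i)).1, fun i => by exact_mod_cast (abs_le.1 (h i)).2⟩

theorem exists_isSmallestMax {n L : ℕ} {P : Set (Fin n → ℝ)} (hP : IsLatticePolytope P)
    (hL : MinkLen P L) :
    ∃ (A : Fin n → ℤ) (v : Fin L → Fin n → ℤ), IsSmallestMax P A v := by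
  obtain ⟨A₀, v₀, h₀⟩ := hL.1
  let D : Set ((Fin n → ℤ) × (Fin L → Fin n → ℤ)) :=
    {p | (∀ i, IsPrim (p.2 i)) ∧ Zono p.1 p.2 ⊆ P}
  let f : (Fin n → ℤ) × (Fin L → Fin n → ℤ) → ℕ := fun p => (coeV ⁻¹' Zono p.1 p.2).ncard
  have hD : D.Nonempty := ⟨(A₀, v₀), h₀⟩
  have hmem := Function.argminOn_mem f D hD
  have hmin : ∀ p ∈ D, f (Function.argminOn f D hD) ≤ f p := fun p hp =>
    Function.argminOn_le f D hp
  generalize Function.argminOn f D hD = p at hmem hmin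
  refine ⟨p.1, p.2, hmem.1, hmem.2, hL, fun B w hw hB hsub => hsub.antisymm ?_⟩
  refine zono_subset_of_preimage_subset (convex_zono _ _) (Eq.symm ?_).subset
  exact Set.eq_of_subset_of_ncard_le (Set.preimage_mono hsub) (hmin (B, w) ⟨hw, hB⟩)
    ((finite_preimage_coeV hP).subset (Set.preimage_mono hmem.2))

/-- A parallelogram spanned by primitive vectors of determinant at least two contains two distinct
lattice points that are congruent modulo two. -/
theorem exists_congruent_lattice_points {v w : Fin 2 → ℤ} (hv : IsPrim v) (hw : IsPrim w)
    (hD : 2 ≤ det₂ v w) :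
    ∃ (a m : Fin 2 → ℤ) (p q p' q' : ℝ), m ≠ 0 ∧
      p ∈ Set.Icc (0 : ℝ) 1 ∧ q ∈ Set.Icc (0 : ℝ) 1 ∧
      p' ∈ Set.Icc (0 : ℝ) 1 ∧ q' ∈ Set.Icc (0 : ℝ) 1 ∧
      coeV a = p • coeV v + q • coeV w ∧
      coeV (a + (2 : ℤ) • m) = p' • coeV v + q' • coeV w := by
  have hv' := (isPrim_iff_isCoprime v).1 hv
  have hw' := (isPrim_iff_isCoprime w).1 hw
  rcases Int.even_or_odd' (det₂ v w) with ⟨k, hk | hk⟩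
  · have hvw : ∃ m : Fin 2 → ℤ, w = v + (2 : ℤ) • m := by
      have hcop : ∀ x y : ℤ, IsCoprime x y → ¬ (x % 2 = 0 ∧ y % 2 = 0) := by
        rintro x y ⟨s, t, h⟩ ⟨hx, hy⟩
        obtain ⟨x', rfl⟩ := Int.dvd_of_emod_eq_zero hx
        obtain ⟨y', rfl⟩ := Int.dvd_of_emod_eq_zero hy
        have : 2 * (s * x' + t * y') = 1 := by linear_combination h
        omega
      have h1 := hcop _ _ hv'
      have h2 := hcop _ _ hw'
      have h3 : (v 0 * w 1) % 2 = (v 1 * w 0) % 2 := by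
        rw [det₂] at hk
        omega
      rw [Int.mul_emod, Int.mul_emod (v 1)] at h3
      have h4 : v 0 % 2 = w 0 % 2 ∧ v 1 % 2 = w 1 % 2 := by
        rcases Int.emod_two_eq (v 0) with ha | ha <;> rcases Int.emod_two_eq (v 1) with hb | hb <;>
        rcases Int.emod_two_eq (w 0) with hc | hc <;> rcases Int.emod_two_eq (w 1) with hd | hd <;>
        rw [ha, hb, hc, hd] at h3 <;> omega
      refine ⟨![(w 0 - v 0) / 2, (w 1 - v 1) / 2], funext fun i => ?_⟩
      fin_cases i
      · simp; omega
      · simp; omega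
    obtain ⟨m, hm⟩ := hvw
    refine ⟨v, m, 1, 0, 0, 1, ?_, by simp, by simp, by simp, by simp, by simp, by rw [← hm]; simp⟩
    rintro rfl
    rw [hm, det₂] at hD
    simp [mul_comm] at hD
  · set D := det₂ v w with hDdef
    have hx : ∃ x : Fin 2 → ℤ, det₂ x w % D ≠ 0 := by
      by_contra! h
      have h0 := Int.dvd_of_emod_eq_zero (h ![1, 0])
      have h1 := Int.dvd_of_emod_eq_zero (h ![0, 1])
      simp only [det₂, Matrix.cons_val_zero, Matrix.cons_val_one, one_mul, zero_mul, sub_zero,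
        zero_sub, dvd_neg] at h0 h1
      have := Int.le_of_dvd one_pos (isUnit_iff_dvd_one.1 (hw'.isUnit_of_dvd' h1 h0))
      omega
    obtain ⟨x, hx⟩ := hx
    set P := det₂ x w % D with hP
    set Q := det₂ v x % D with hQ
    set y : Fin 2 → ℤ := x - (det₂ x w / D) • v - (det₂ v x / D) • w with hy
    have hP0 : 0 < P := lt_of_le_of_ne (Int.emod_nonneg _ (by omega)) (Ne.symm hx)
    have hPD : P < D := Int.emod_lt_of_pos _ (by omega)
    have hQ0 : 0 ≤ Q := Int.emod_nonneg _ (by omega)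
    have hQD : Q < D := Int.emod_lt_of_pos _ (by omega)
    have eP : det₂ y w = P := by
      rw [hP, Int.emod_def, hy]
      simp only [hDdef, det₂, Pi.sub_apply, Pi.smul_apply, smul_eq_mul]
      ring
    have eQ : det₂ v y = Q := by
      rw [hQ, Int.emod_def, hy]
      simp only [hDdef, det₂, Pi.sub_apply, Pi.smul_apply, smul_eq_mul]
      ring
    have hDy : ∀ i, D * y i = P * v i + Q * w i := by
      intro i
      rw [← eP, ← eQ, hDdef]
      fin_cases i <;> simp only [det₂, Fin.zero_eta, Fin.mk_one] <;> ring
    clear_value P Q y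
    obtain ⟨ε, P', hP', hε0, hε1⟩ : ∃ ε P' : ℤ, P = 2 * P' + ε ∧ 0 ≤ ε ∧ ε ≤ 1 :=
      ⟨P % 2, P / 2, by omega, by omega, by omega⟩
    obtain ⟨δ, Q', hQ', hδ0, hδ1⟩ : ∃ δ Q' : ℤ, Q = 2 * Q' + δ ∧ 0 ≤ δ ∧ δ ≤ 1 :=
      ⟨Q % 2, Q / 2, by omega, by omega, by omega⟩
    have hym : ε • v + δ • w + (2 : ℤ) • (P' • v + Q' • w - k • y) = y := by
      funext i
      have := hDy i
      rw [hk, hP', hQ'] at this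
      simp only [Pi.add_apply, Pi.sub_apply, Pi.smul_apply, smul_eq_mul]
      linear_combination -this
    have hDpos : (0 : ℝ) < D := by exact_mod_cast (by omega : 0 < D)
    refine ⟨ε • v + δ • w, P' • v + Q' • w - k • y, ε, δ, P / D, Q / D, fun h0 => ?_,
      ⟨by exact_mod_cast hε0, by exact_mod_cast hε1⟩,
      ⟨by exact_mod_cast hδ0, by exact_mod_cast hδ1⟩,
      ⟨by positivity, ?_⟩, ⟨by positivity, ?_⟩, ?_, ?_⟩
    · have : P = ε * D := by
        rw [← eP, ← hym, h0, hDdef]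
        simp only [det₂, Pi.add_apply, Pi.smul_apply, Pi.zero_apply, smul_eq_mul]
        ring
      rcases (by omega : ε = 0 ∨ ε = 1) with rfl | rfl <;> omega
    · rw [div_le_one hDpos]; exact_mod_cast hPD.le
    · rw [div_le_one hDpos]; exact_mod_cast hQD.le
    · ext i; simp [coeV]
    · rw [hym]
      ext i
      have : (D : ℝ) * y i = P * v i + Q * w i := by exact_mod_cast hDy i
      simp only [coeV, Pi.add_apply, Pi.smul_apply, smul_eq_mul]
      field_simp
      linarith

theorem exists_double_segment {v w : Fin 2 → ℤ} (hv : IsPrim v) (hw : IsPrim w)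
    (hD : 2 ≤ |det₂ v w|) :
    ∃ a u : Fin 2 → ℤ, IsPrim u ∧ ∀ s ∈ Set.Icc (0 : ℝ) 2, ∃ p ∈ Set.Icc (0 : ℝ) 1,
      ∃ q ∈ Set.Icc (0 : ℝ) 1, coeV a + s • coeV u = p • coeV v + q • coeV w := by
  wlog hpos : 0 ≤ det₂ v w generalizing v w
  · have hs : det₂ w v = - det₂ v w := by simp only [det₂]; ring
    obtain ⟨a, u, hu, h⟩ := this hw hv (by rwa [hs, abs_neg]) (by rw [hs]; omega)
    refine ⟨a, u, hu, fun s hs => ?_⟩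
    obtain ⟨p, hp, q, hq, e⟩ := h s hs
    exact ⟨q, hq, p, hp, by rw [e, add_comm]⟩
  rw [abs_of_nonneg hpos] at hD
  obtain ⟨a, m, p, q, p', q', hm, hp, hq, hp', hq', e, e'⟩ :=
    exists_congruent_lattice_points hv hw hD
  obtain ⟨g, u, hg, hu, rfl⟩ := exists_eq_smul_isPrim hm
  refine ⟨a, u, hu, fun s hs => ?_⟩
  have hg' : (1 : ℝ) ≤ g := by exact_mod_cast hg
  have hg0 : (0 : ℝ) < g := by linarith
  have hr0 : 0 ≤ s / (2 * g) := div_nonneg hs.1 (by linarith)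
  have hr1 : s / (2 * g) ≤ 1 := by
    rw [div_le_one (by linarith)]; linarith [hs.2]
  refine ⟨_, convex_Icc (0 : ℝ) 1 hp hp' (sub_nonneg.2 hr1) hr0 (by ring),
    _, convex_Icc (0 : ℝ) 1 hq hq' (sub_nonneg.2 hr1) hr0 (by ring), ?_⟩
  have e2 : coeV (a + (2 : ℤ) • g • u) = coeV a + (2 * g : ℝ) • coeV u := by
    ext i; simp [coeV]; ring
  rw [e2, e] at e'
  have hsr : s • coeV u = (s / (2 * g)) • (2 * g : ℝ) • coeV u := by
    rw [smul_smul]; congr 1; field_simp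
  rw [hsr, e, eq_sub_of_add_eq' e']
  simp only [smul_eq_mul]
  module

theorem abs_det₂_le_one_of_isSmallestMax {L : ℕ} {P : Set (Fin 2 → ℝ)} {A : Fin 2 → ℤ}
    {v : Fin L → Fin 2 → ℤ} (h : IsSmallestMax P A v) (i j : Fin L) : |det₂ (v i) (v j)| ≤ 1 := by
  obtain ⟨hprim, hsub, -, hmin⟩ := h
  by_contra! hD
  have hij : i ≠ j := by
    rintro rfl
    simp [det₂, mul_comm] at hD
  obtain ⟨a, u, hu, hau⟩ := exists_double_segment (hprim i) (hprim j) (by omega)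
  have split : ∀ {M : Type} [AddCommMonoid M] (f : Fin L → M),
      ∑ k, f k = f i + f j + ∑ k ∈ {i, j}ᶜ, f k := fun f => by
    rw [← Finset.sum_pair hij, Finset.sum_add_sum_compl]
  set w : Fin L → Fin 2 → ℤ := fun k => if k = i ∨ k = j then u else v k with hw
  have hwi : w i = u := by simp [hw]
  have hwj : w j = u := by simp [hw]
  have hwk : ∀ k ∈ ({i, j}ᶜ : Finset (Fin L)), w k = v k := fun k hk => by
    simp only [Finset.mem_compl, Finset.mem_insert, Finset.mem_singleton] at hk
    simp [hw, hk]
  have hle : Zono (A + a) w ⊆ Zono A v := by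
    intro x hx
    obtain ⟨t, ht, rfl⟩ := mem_zono.1 hx
    obtain ⟨p, hp, q, hq, e⟩ := hau (t i + t j)
      ⟨add_nonneg (ht i).1 (ht j).1, by linarith [(ht i).2, (ht j).2]⟩
    refine mem_zono.2 ⟨fun k => if k = i then p else if k = j then q else t k,
      fun k => by dsimp only; split_ifs <;> simp_all only, ?_⟩
    rw [split, split (fun k => _ • coeV (v k)), hwi, hwj]
    have hrest : ∑ k ∈ {i, j}ᶜ, t k • coeV (w k) =
        ∑ k ∈ {i, j}ᶜ, (if k = i then p else if k = j then q else t k) • coeV (v k) := by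
      refine Finset.sum_congr rfl fun k hk => ?_
      rw [hwk k hk]
      simp only [Finset.mem_compl, Finset.mem_insert, Finset.mem_singleton, not_or] at hk
      simp [hk]
    have hA : coeV (A + a) = coeV A + coeV a := by ext; simp [coeV]
    rw [hrest, hA, if_pos rfl, if_neg hij.symm, if_pos rfl, ← e]
    module
  have heq := hmin (A + a) w (fun k => by by_cases hk : k = i ∨ k = j <;> simp [hw, hk, hu, hprim k])
    (hle.trans hsub) hle
  let φ : (Fin 2 → ℝ) →ₗ[ℝ] ℝ :=
    (u 0 : ℝ) • LinearMap.proj 1 - (u 1 : ℝ) • LinearMap.proj 0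
  have hφ : ∀ x, φ (coeV x) = det₂ u x := fun x => by simp [φ, coeV, det₂]
  have hwid := sum_abs_le_of_zono_subset heq.symm.subset φ
  rw [split, split (fun k => |φ (coeV (w k))|), hwi, hwj,
    Finset.sum_congr rfl fun k hk => congrArg (fun x => |φ (coeV x)|) (hwk k hk)] at hwid
  have huu : det₂ u u = 0 := by simp [det₂, mul_comm]
  simp only [hφ, huu, Int.cast_zero, abs_zero, add_zero] at hwid
  have h1 : |(det₂ u (v i) : ℝ)| = 0 := by
    linarith [abs_nonneg (det₂ u (v i) : ℝ), abs_nonneg (det₂ u (v j) : ℝ)]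
  have h2 : |(det₂ u (v j) : ℝ)| = 0 := by
    linarith [abs_nonneg (det₂ u (v i) : ℝ), abs_nonneg (det₂ u (v j) : ℝ)]
  have h1' : det₂ u (v i) = 0 := by exact_mod_cast abs_eq_zero.1 h1
  have h2' : det₂ u (v j) = 0 := by exact_mod_cast abs_eq_zero.1 h2
  have hzero : det₂ (v i) (v j) = 0 := by
    obtain ⟨s, t, hst⟩ := (isPrim_iff_isCoprime u).1 hu
    simp only [det₂] at h1' h2' ⊢
    linear_combination (-(v i 0 * v j 1 - v i 1 * v j 0)) * hst -
      (t * v j 1 + s * v j 0) * h1' + (t * v i 1 + s * v i 0) * h2'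
  rw [hzero] at hD
  simp at hD

theorem exists_matrix_of_det₂_eq_zero {L : ℕ} {v : Fin L → Fin 2 → ℤ} (hv : ∀ i, IsPrim (v i))
    (h : ∀ i j, det₂ (v i) (v j) = 0) :
    ∃ M : Matrix (Fin 2) (Fin 2) ℤ, IsUnit M.det ∧
      ∀ i, M.mulVec (v i) = ![1, 0] ∨ M.mulVec (v i) = -![1, 0] := by
  rcases isEmpty_or_nonempty (Fin L) with hL | ⟨⟨k⟩⟩
  · exact ⟨1, by simp, fun i => hL.elim i⟩
  obtain ⟨s, t, hst⟩ := (isPrim_iff_isCoprime _).1 (hv k)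
  refine ⟨!![s, t; -v k 1, v k 0], ?_, fun i => ?_⟩
  · rw [Matrix.det_fin_two_of]
    exact IsUnit.of_mul_eq_one 1 (by linear_combination hst)
  have hki := h k i
  simp only [det₂] at hki
  have hu : IsUnit (s * v i 0 + t * v i 1) := by
    refine ((isPrim_iff_isCoprime _).1 (hv i)).isUnit_of_dvd' ⟨v k 0, ?_⟩ ⟨v k 1, ?_⟩
    · linear_combination (-v i 0) * hst + (-t) * hki
    · linear_combination (-v i 1) * hst + s * hki
  have h1 : -(v k 1 * v i 0) + v k 0 * v i 1 = 0 := by linear_combination hki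
  rcases Int.isUnit_iff.1 hu with h0 | h0
  · left
    ext l
    fin_cases l <;> simp [Matrix.mulVec, dotProduct, Fin.sum_univ_two, h0, h1]
  · right
    ext l
    fin_cases l <;> simp [Matrix.mulVec, dotProduct, Fin.sum_univ_two, h0, h1]

/-- Primitive vectors with pairwise determinants at most one in absolute value are, up to a
unimodular map and signs, among `e₁`, `e₂` and `e₁ + e₂`. -/
theorem exists_matrix_of_abs_det₂_le_one {L : ℕ} {v : Fin L → Fin 2 → ℤ}
    (hv : ∀ i, IsPrim (v i)) (h : ∀ i j, |det₂ (v i) (v j)| ≤ 1) :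
    ∃ M : Matrix (Fin 2) (Fin 2) ℤ, IsUnit M.det ∧
      ∀ i, ∃ c ∈ ({![1, 0], ![0, 1], ![1, 1]} : Set (Fin 2 → ℤ)),
        M.mulVec (v i) = c ∨ M.mulVec (v i) = -c := by
  by_cases h0 : ∀ i j, det₂ (v i) (v j) = 0
  · obtain ⟨M, hM, hc⟩ := exists_matrix_of_det₂_eq_zero hv h0
    exact ⟨M, hM, fun i => ⟨![1, 0], by simp, hc i⟩⟩
  push Not at h0
  obtain ⟨i, j, hij⟩ := h0
  have habs : ∀ k l, -1 ≤ det₂ (v k) (v l) ∧ det₂ (v k) (v l) ≤ 1 := fun k l => abs_le.1 (h k l)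
  have hD : det₂ (v i) (v j) = 1 ∨ det₂ (v i) (v j) = -1 := by
    have := habs i j
    omega
  have hDD : det₂ (v i) (v j) * det₂ (v i) (v j) = 1 := by rcases hD with hD | hD <;> rw [hD] <;> rfl
  have hplucker : ∀ k l, det₂ (v k) (v j) * det₂ (v i) (v l) - det₂ (v i) (v k) * det₂ (v l) (v j) =
      det₂ (v i) (v j) * det₂ (v k) (v l) := fun k l => by
    simp only [det₂]; ring
  have hne : ∀ k, ¬ (det₂ (v k) (v j) = 0 ∧ det₂ (v i) (v k) = 0) := by
    rintro k ⟨h1, h2⟩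
    obtain ⟨s, t, hst⟩ := (isPrim_iff_isCoprime _).1 (hv k)
    have e0 : det₂ (v i) (v j) * v k 0 = det₂ (v k) (v j) * v i 0 + det₂ (v i) (v k) * v j 0 := by
      simp only [det₂]; ring
    have e1 : det₂ (v i) (v j) * v k 1 = det₂ (v k) (v j) * v i 1 + det₂ (v i) (v k) * v j 1 := by
      simp only [det₂]; ring
    rw [h1, h2] at e0 e1
    exact hij (by linear_combination s * e0 + t * e1 - det₂ (v i) (v j) * hst)
  obtain ⟨σ, hσ, hsame⟩ : ∃ σ : ℤ, (σ = 1 ∨ σ = -1) ∧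
      ∀ k, det₂ (v k) (v j) * (σ * det₂ (v i) (v k)) ≠ -1 := by
    by_cases hex : ∃ k, det₂ (v k) (v j) * det₂ (v i) (v k) = -1
    · obtain ⟨k, hk⟩ := hex
      refine ⟨-1, Or.inr rfl, fun l hl => ?_⟩
      have hkl := hplucker k l
      have := habs k l
      have hl' : det₂ (v l) (v j) * det₂ (v i) (v l) = 1 := by linarith
      rcases Int.mul_eq_one_iff_eq_one_or_neg_one.1 hl' with ⟨a1, a2⟩ | ⟨a1, a2⟩ <;>
      rcases Int.mul_eq_neg_one_iff_eq_one_or_neg_one.1 hk with ⟨b1, b2⟩ | ⟨b1, b2⟩ <;>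
      rcases hD with hD | hD <;>
      rw [a1, a2, b1, b2, hD] at hkl <;> omega
    · push Not at hex
      exact ⟨1, Or.inl rfl, fun k => by simpa using hex k⟩
  refine ⟨!![v j 1, -v j 0; -σ * v i 1, σ * v i 0], ?_, fun k => ?_⟩
  · rw [Matrix.det_fin_two_of]
    refine IsUnit.of_mul_eq_one (σ * det₂ (v i) (v j)) ?_
    have hσσ : σ * σ = 1 := by rcases hσ with rfl | rfl <;> rfl
    calc _ = (σ * σ) * (det₂ (v i) (v j) * det₂ (v i) (v j)) := by simp only [det₂]; ring
      _ = 1 := by rw [hσσ, hDD, one_mul]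
  · have hMv : !![v j 1, -v j 0; -σ * v i 1, σ * v i 0].mulVec (v k) =
        ![det₂ (v k) (v j), σ * det₂ (v i) (v k)] := by
      ext l
      fin_cases l <;> simp [Matrix.mulVec, dotProduct, Fin.sum_univ_two, det₂] <;> ring
    rw [hMv]
    have hne' : ¬ (det₂ (v k) (v j) = 0 ∧ σ * det₂ (v i) (v k) = 0) := by
      have := hne k
      rcases hσ with rfl | rfl <;> simpa using this
    have hb : -1 ≤ σ * det₂ (v i) (v k) ∧ σ * det₂ (v i) (v k) ≤ 1 := by
      have := habs i k
      rcases hσ with rfl | rfl <;> omega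
    have hs := hsame k
    have ha := habs k j
    generalize det₂ (v k) (v j) = a at *
    generalize σ * det₂ (v i) (v k) = b at *
    obtain ⟨ha1, ha2⟩ := ha
    obtain ⟨hb1, hb2⟩ := hb
    interval_cases a <;> interval_cases b <;> simp_all

theorem image_affine_zono {L : ℕ} (M : Matrix (Fin 2) (Fin 2) ℤ) (A B : Fin 2 → ℤ)
    (v : Fin L → Fin 2 → ℤ) :
    (fun x : Fin 2 → ℝ => (M.map (Int.cast : ℤ → ℝ)).mulVec x + coeV B) '' Zono A v =
      Zono (M.mulVec A + B) (fun i => M.mulVec (v i)) := by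
  have hM : ∀ x : Fin 2 → ℤ, (M.map (Int.cast : ℤ → ℝ)).mulVec (coeV x) = coeV (M.mulVec x) :=
    fun x => by ext i; simp [coeV, Matrix.mulVec, dotProduct]
  have key : ∀ t : Fin L → ℝ,
      (M.map (Int.cast : ℤ → ℝ)).mulVec (coeV A + ∑ i, t i • coeV (v i)) + coeV B =
        coeV (M.mulVec A + B) + ∑ i, t i • coeV (M.mulVec (v i)) := fun t => by
    have hadd : coeV (M.mulVec A + B) = coeV (M.mulVec A) + coeV B := by ext; simp [coeV]
    rw [Matrix.mulVec_add, Matrix.mulVec_sum]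
    simp only [Matrix.mulVec_smul, hM, hadd]
    abel
  ext x
  simp only [Set.mem_image, mem_zono]
  constructor
  · rintro ⟨_, ⟨t, ht, rfl⟩, rfl⟩
    exact ⟨t, ht, key t⟩
  · rintro ⟨t, ht, rfl⟩
    exact ⟨_, ⟨t, ht, rfl⟩, key t⟩

theorem segment_neg_eq {n : ℕ} (c : Fin n → ℤ) :
    segment ℝ 0 (coeV (-c)) = {coeV (-c)} + segment ℝ 0 (coeV c) := by
  have h : coeV (-c) + coeV c = 0 := by ext; simp [coeV]
  rw [Set.singleton_add, segment_translate_image, h, add_zero, segment_symm]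

theorem exists_zono_eq_sum_smul {L : ℕ} (v : Fin L → Fin 2 → ℤ)
    (hv : ∀ i, ∃ c ∈ ({![1, 0], ![0, 1], ![1, 1]} : Set (Fin 2 → ℤ)), v i = c ∨ v i = -c) :
    ∃ (B : Fin 2 → ℤ) (n₁ n₂ n₃ : ℕ), n₁ + n₂ + n₃ = L ∧
      Zono B v = (n₁ : ℝ) • segment ℝ 0 (coeV ![1, 0]) + (n₂ : ℝ) • segment ℝ 0 (coeV ![0, 1]) +
        (n₃ : ℝ) • segment ℝ 0 (coeV ![1, 1]) := by
  induction L with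
  | zero =>
    refine ⟨0, 0, 0, 0, rfl, ?_⟩
    have hc : coeV (0 : Fin 2 → ℤ) = 0 := by ext; simp [coeV]
    have hs : ∀ c : Fin 2 → ℝ, (0 : ℝ) • segment ℝ 0 c = 0 := fun c =>
      Set.zero_smul_set ⟨0, left_mem_segment ℝ 0 c⟩
    simp [Zono, hc, hs, Set.singleton_zero]
  | succ L ih =>
    obtain ⟨B, n₁, n₂, n₃, hn, hB⟩ := ih (fun i => v i.succ) fun i => hv i.succ
    obtain ⟨c, hc, hvc⟩ := hv 0
    obtain ⟨b, hb⟩ : ∃ b : Fin 2 → ℤ,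
        ({coeV b} + segment ℝ 0 (coeV (v 0)) : Set (Fin 2 → ℝ)) = segment ℝ 0 (coeV c) := by
      rcases hvc with h | h
      · refine ⟨0, ?_⟩
        have h0 : coeV (0 : Fin 2 → ℤ) = 0 := by ext; simp [coeV]
        rw [h, h0, Set.singleton_zero, zero_add]
      · refine ⟨c, ?_⟩
        have h0 : coeV c + coeV (-c) = 0 := by ext; simp [coeV]
        rw [h, segment_neg_eq, ← add_assoc, Set.singleton_add_singleton, h0, Set.singleton_zero,
          zero_add]
    have hstep : Zono (B + b) v = Zono B (fun i => v i.succ) + segment ℝ 0 (coeV c) := by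
      have hadd : ({coeV (B + b)} : Set (Fin 2 → ℝ)) = {coeV B} + {coeV b} := by
        rw [Set.singleton_add_singleton]
        congr 1
        ext; simp [coeV]
      rw [← hb, Zono, Zono, Fin.sum_univ_succ, hadd]
      abel
    have hsucc : ∀ (n : ℕ) (x : Fin 2 → ℝ),
        ((n + 1 : ℕ) : ℝ) • segment ℝ 0 x = (n : ℝ) • segment ℝ 0 x + segment ℝ 0 x := fun n x => by
      rw [Nat.cast_succ, (convex_segment _ _).add_smul n.cast_nonneg zero_le_one, one_smul]
    rcases hc with rfl | rfl | rfl
    · exact ⟨B + b, n₁ + 1, n₂, n₃, by omega, by rw [hstep, hB, hsucc]; abel⟩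
    · exact ⟨B + b, n₁, n₂ + 1, n₃, by omega, by rw [hstep, hB, hsucc]; abel⟩
    · exact ⟨B + b, n₁, n₂, n₃ + 1, by omega, by rw [hstep, hB, hsucc]; abel⟩

/-- Every lattice polygon admits a smallest maximal decomposition which is equivalent, under
an affine unimodular transformation, to `n₁[0,e₁] + n₂[0,e₂] + n₃[0,e₁+e₂]` with
`n₁ + n₂ + n₃ = L(P)`. -/
theorem stmt5 {L : ℕ} (P : Set (Fin 2 → ℝ)) (hP : IsLatticePolytope P) (hL : MinkLen P L) :
    ∃ (A : Fin 2 → ℤ) (v : Fin L → Fin 2 → ℤ), IsSmallestMax P A v ∧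
      ∃ (M : Matrix (Fin 2) (Fin 2) ℤ) (B : Fin 2 → ℤ) (n₁ n₂ n₃ : ℕ),
        IsUnit M.det ∧ n₁ + n₂ + n₃ = L ∧
        (fun x : Fin 2 → ℝ => (M.map (Int.cast : ℤ → ℝ)).mulVec x + coeV B) '' Zono A v =
          (n₁ : ℝ) • segment ℝ 0 (coeV ![1, 0]) + (n₂ : ℝ) • segment ℝ 0 (coeV ![0, 1]) +
            (n₃ : ℝ) • segment ℝ 0 (coeV ![1, 1]) := by
  obtain ⟨A, v, h⟩ := exists_isSmallestMax hP hL
  obtain ⟨M, hM, hc⟩ :=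
    exists_matrix_of_abs_det₂_le_one h.1 (abs_det₂_le_one_of_isSmallestMax h)
  obtain ⟨B, n₁, n₂, n₃, hn, hB⟩ := exists_zono_eq_sum_smul (fun i => M.mulVec (v i)) hc
  exact ⟨A, v, h, M, B - M.mulVec A, n₁, n₂, n₃, hM, hn, by
    rw [image_affine_zono, add_sub_cancel, hB]⟩
end

section
/- Let Δ be the standard 2-simplex with vertices (0,0), (1,0), (0,1), and let Δ' be any lattice triangle in ℝ² with L(Δ') = 1 that is not a translate of Δ but whose sides have direction classes compatible with Δ (each side's direction vector is, up to sign, one of (1,0), (0,1), (1,1) unless forced otherwise). Then L(Δ + Δ') ≥ 3. More precisely: if Q₁ and Q₂ are lattice triangles in ℝ² with L(Q₁) = L(Q₂) = 1 and L(Q₁ + Q₂) = 2, then Q₂ is a translate of Q₁. -/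
open Pointwise

/-- A lattice triangle: the convex hull of three affinely independent lattice points. -/
def IsLatticeTriangle (Q : Set (Fin 2 → ℝ)) : Prop :=
  ∃ a b c : Fin 2 → ℤ, AffineIndependent ℝ ![coeV a, coeV b, coeV c] ∧
    Q = convexHull ℝ {coeV a, coeV b, coeV c}

/-- The determinant of a pair of planar lattice vectors. -/
def cross (a b : Fin 2 → ℤ) : ℤ := a 0 * b 1 - a 1 * b 0

lemma exists_primitive_smul {n : ℕ} {e : Fin n → ℤ} (he : e ≠ 0) :
    ∃ (m : ℤ) (e' : Fin n → ℤ), 0 < m ∧ IsPrim e' ∧ e = m • e' := by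
  have hne : (Finset.univ : Finset (Fin n)).Nonempty := by
    by_contra h
    apply he
    funext i
    exact absurd ⟨i, Finset.mem_univ i⟩ h
  obtain ⟨g, hg, hg1⟩ := Finset.extract_gcd e hne
  have h0 : 0 ≤ Finset.univ.gcd e := Int.nonneg_of_normalize_eq_self Finset.normalize_gcd
  refine ⟨Finset.univ.gcd e, g, lt_of_le_of_ne h0 fun h ↦ he ?_, hg1, ?_⟩
  · funext i
    rw [hg i (Finset.mem_univ i), ← h]
    simp
  · funext i
    simpa using hg i (Finset.mem_univ i)

lemma exists_cross_eq_one {a : Fin 2 → ℤ} (ha : IsPrim a) : ∃ r, cross a r = 1 := by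
  have h : IsCoprime (a 0) (a 1) := by
    rw [Int.isCoprime_iff_gcd_eq_one]
    have hdvd : ((Int.gcd (a 0) (a 1) : ℕ) : ℤ) ∣ Finset.univ.gcd a := by
      refine Finset.dvd_gcd fun i _ ↦ ?_
      fin_cases i
      · exact Int.gcd_dvd_left ..
      · exact Int.gcd_dvd_right ..
    rw [show Finset.univ.gcd a = 1 from ha] at hdvd
    exact Nat.dvd_one.mp (by exact_mod_cast hdvd)
  obtain ⟨s, t, hst⟩ := h
  refine ⟨![-t, s], ?_⟩
  simp only [cross, Matrix.cons_val_zero, Matrix.cons_val_one]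
  linarith

lemma coeV_add {n : ℕ} (a b : Fin n → ℤ) : coeV (a + b) = coeV a + coeV b := by
  funext i
  simp [coeV]

lemma coeV_smul {n : ℕ} (m : ℤ) (a : Fin n → ℤ) : coeV (m • a) = (m : ℝ) • coeV a := by
  funext i
  simp [coeV]

lemma coeV_zero {n : ℕ} : coeV (0 : Fin n → ℤ) = 0 := by
  funext i
  simp [coeV]

/-- A lattice point that is a rational convex combination of three lattice points of a
convex set lies in that set. -/
lemma Convex.coeV_mem {n : ℕ} {Q : Set (Fin n → ℝ)} (hQ : Convex ℝ Q) {p q r x : Fin n → ℤ}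
    (hp : coeV p ∈ Q) (hq : coeV q ∈ Q) (hr : coeV r ∈ Q) {α β γ : ℤ} (hα : 0 ≤ α)
    (hβ : 0 ≤ β) (hγ : 0 ≤ γ) (hpos : 0 < α + β + γ)
    (h : α • p + β • q + γ • r = (α + β + γ) • x) : coeV x ∈ Q := by
  have hm : (0 : ℝ) < (α : ℝ) + β + γ := by exact_mod_cast hpos
  have h' := congrArg coeV h
  simp only [coeV_add, coeV_smul, Int.cast_add] at h'
  have hx : coeV x = ((α : ℝ) / (α + β + γ)) • coeV p + ((β : ℝ) / (α + β + γ)) • coeV q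
      + ((γ : ℝ) / (α + β + γ)) • coeV r := by
    have : coeV x = ((α : ℝ) + β + γ)⁻¹ • (((α : ℝ) + β + γ) • coeV x) := by
      rw [smul_smul, inv_mul_cancel₀ hm.ne', one_smul]
    rw [this, ← h']
    simp only [smul_add, smul_smul, div_eq_inv_mul]
  rw [hx]
  have hα' : (0 : ℝ) ≤ α := by exact_mod_cast hα
  have hβ' : (0 : ℝ) ≤ β := by exact_mod_cast hβ
  have hγ' : (0 : ℝ) ≤ γ := by exact_mod_cast hγ
  have := hQ.sum_mem (t := Finset.univ)
    (w := ![(α : ℝ) / (α + β + γ), (β : ℝ) / (α + β + γ), (γ : ℝ) / (α + β + γ)])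
    (z := ![coeV p, coeV q, coeV r]) ?_ ?_ ?_
  · simpa [Fin.sum_univ_three] using this
  · intro i _
    fin_cases i <;> simp <;> positivity
  · simp [Fin.sum_univ_three]
    field_simp
  · intro i _
    fin_cases i <;> simpa

lemma segment_coeV_subset {n : ℕ} {m : ℤ} (hm : 0 < m) (e : Fin n → ℤ) :
    segment ℝ 0 (coeV e) ⊆ segment ℝ 0 (coeV (m • e)) := by
  apply (convex_segment _ _).segment_subset (left_mem_segment _ _ _)
  rw [← coeV_zero]
  refine (convex_segment _ _).coeV_mem (p := 0) (q := 0) (r := m • e) (α := m - 1) (β := 0)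
    (γ := 1) (left_mem_segment _ _ _) (left_mem_segment _ _ _) (right_mem_segment _ _ _)
    (by lia) le_rfl zero_le_one (by lia) (by simp)

lemma isDecomp_three_of_mem {n : ℕ} {P : Set (Fin n → ℝ)} (hP : Convex ℝ P)
    {x e f g : Fin n → ℤ} (he : e ≠ 0) (hf : f ≠ 0) (hg : g ≠ 0)
    (h : ∀ y ∈ ({0, e} : Set (Fin n → ℤ)), ∀ z ∈ ({0, f} : Set (Fin n → ℤ)),
      ∀ w ∈ ({0, g} : Set (Fin n → ℤ)), coeV (x + (y + z + w)) ∈ P) :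
    IsDecomp P 3 := by
  obtain ⟨k, e', hk, he', rfl⟩ := exists_primitive_smul he
  obtain ⟨l, f', hl, hf', rfl⟩ := exists_primitive_smul hf
  obtain ⟨m, g', hm, hg', rfl⟩ := exists_primitive_smul hg
  refine ⟨x, ![e', f', g'], ?_, ?_⟩
  · intro i
    fin_cases i <;> simpa
  · have hsub : Zono x ![e', f', g'] ⊆ {coeV x} + (segment ℝ 0 (coeV (k • e'))
        + segment ℝ 0 (coeV (l • f')) + segment ℝ 0 (coeV (m • g'))) := by
      simp only [Zono, Fin.sum_univ_three]
      exact Set.add_subset_add_left (Set.add_subset_add (Set.add_subset_add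
        (segment_coeV_subset hk e') (segment_coeV_subset hl f')) (segment_coeV_subset hm g'))
    refine hsub.trans ?_
    rw [← convexHull_singleton (𝕜 := ℝ) (coeV x), ← convexHull_pair, ← convexHull_pair,
      ← convexHull_pair, ← convexHull_add, ← convexHull_add, ← convexHull_add]
    apply convexHull_min _ hP
    rintro _ ⟨_, rfl, _, ⟨_, ⟨y, hy, z, hz, rfl⟩, w, hw, rfl⟩, rfl⟩
    have key : ∀ v : Fin n → ℤ, ∀ y ∈ ({0, coeV v} : Set (Fin n → ℝ)),
        ∃ y' ∈ ({0, v} : Set (Fin n → ℤ)), coeV y' = y := by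
      rintro v y (rfl | rfl)
      · exact ⟨0, by simp, coeV_zero⟩
      · exact ⟨v, by simp, rfl⟩
    obtain ⟨y', hy', rfl⟩ := key _ y hy
    obtain ⟨z', hz', rfl⟩ := key _ z hz
    obtain ⟨w', hw', rfl⟩ := key _ w hw
    simpa only [coeV_add] using h y' hy' z' hz' w' hw'

lemma isDecomp_three_of_three_smul {n : ℕ} {P : Set (Fin n → ℝ)} (hP : Convex ℝ P)
    {x w : Fin n → ℤ} (hw : w ≠ 0) (hx : coeV x ∈ P) (hy : coeV (x + (3 : ℤ) • w) ∈ P) :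
    IsDecomp P 3 := by
  have h1 : coeV (x + w) ∈ P :=
    hP.coeV_mem hx hx hy (α := 2) (β := 0) (γ := 1) (by lia) (by lia) (by lia) (by lia)
      (by module)
  have h2 : coeV (x + (2 : ℤ) • w) ∈ P :=
    hP.coeV_mem hx hx hy (α := 1) (β := 0) (γ := 2) (by lia) (by lia) (by lia) (by lia)
      (by module)
  have e2 : w + w = (2 : ℤ) • w := by module
  have e3 : (2 : ℤ) • w + w = (3 : ℤ) • w := by module
  refine isDecomp_three_of_mem hP (x := x) hw hw hw ?_
  rintro y (rfl | rfl) z (rfl | rfl) t (rfl | rfl) <;>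
    simpa only [add_zero, zero_add, e2, e3]

/-- The differences of distinct vertices of the standard simplex. -/
def rootsA2 : List (ℤ × ℤ) := [(1, 0), (0, 1), (-1, 0), (0, -1), (1, -1), (-1, 1)]

/-- The nine sums of a vertex of the standard simplex and a vertex of the triangle with
vertices `0`, `c`, `d`. -/
def vertexSums (c d : ℤ × ℤ) : List (ℤ × ℤ) :=
  [0, (1, 0), (0, 1), c, (1, 0) + c, (0, 1) + c, d, (1, 0) + d, (0, 1) + d]

lemma exists_cube_in_vertexSums : ∀ c ∈ rootsA2, ∀ d ∈ rootsA2, c.1 * d.2 - c.2 * d.1 = 1 →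
    (c, d) ∈ [(((1, 0), (0, 1)) : (ℤ × ℤ) × (ℤ × ℤ)), ((-1, 1), (-1, 0)), ((0, -1), (1, -1))] ∨
    ∃ x ∈ vertexSums c d, ∃ e ∈ rootsA2, ∃ f ∈ rootsA2, ∃ g ∈ rootsA2,
      ∀ y ∈ [0, e], ∀ z ∈ [0, f], ∀ w ∈ [0, g], x + (y + z + w) ∈ vertexSums c d := by
  decide

lemma sub_mem_rootsA2 {S : Set (ℤ × ℤ)}
    (h3 : ∀ x w : ℤ × ℤ, x ∈ S → x + (3 : ℤ) • w ∈ S → w = 0) {o c d : ℤ × ℤ}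
    (hmem : ∀ u ∈ [(0 : ℤ × ℤ), (1, 0), (0, 1)], ∀ v ∈ [0, c, d], o + (u + v) ∈ S)
    {v v' : ℤ × ℤ} (hv : v ∈ [0, c, d]) (hv' : v' ∈ [0, c, d])
    (hd : ¬ 3 ∣ (v' - v).1 - (v' - v).2) : v' - v ∈ rootsA2 := by
  have hroot : ∃ h ∈ rootsA2, ∃ w : ℤ × ℤ, v' - v = h + (3 : ℤ) • w := by
    generalize v' - v = t at hd ⊢
    obtain ⟨i, j⟩ := t
    have key : ∀ h ∈ rootsA2, 3 ∣ i - h.1 → 3 ∣ j - h.2 →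
        ∃ h ∈ rootsA2, ∃ w : ℤ × ℤ, (i, j) = h + (3 : ℤ) • w := by
      rintro h hh ⟨s, hs⟩ ⟨t, ht⟩
      refine ⟨h, hh, (s, t), Prod.ext ?_ ?_⟩ <;> simp <;> lia
    simp only at hd
    have hcases : (i % 3 = 1 ∧ j % 3 = 0) ∨ (i % 3 = 0 ∧ j % 3 = 1) ∨ (i % 3 = 2 ∧ j % 3 = 0) ∨
        (i % 3 = 0 ∧ j % 3 = 2) ∨ (i % 3 = 1 ∧ j % 3 = 2) ∨ (i % 3 = 2 ∧ j % 3 = 1) := by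
      lia
    rcases hcases with h | h | h | h | h | h
    · exact key (1, 0) (by decide) (by simp only; lia) (by simp only; lia)
    · exact key (0, 1) (by decide) (by simp only; lia) (by simp only; lia)
    · exact key (-1, 0) (by decide) (by simp only; lia) (by simp only; lia)
    · exact key (0, -1) (by decide) (by simp only; lia) (by simp only; lia)
    · exact key (1, -1) (by decide) (by simp only; lia) (by simp only; lia)
    · exact key (-1, 1) (by decide) (by simp only; lia) (by simp only; lia)
  have hdiff : ∀ h ∈ rootsA2, ∃ α ∈ [(0 : ℤ × ℤ), (1, 0), (0, 1)],
      ∃ β ∈ [(0 : ℤ × ℤ), (1, 0), (0, 1)], h + α = β := by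
    decide
  obtain ⟨h, hh, w, hw⟩ := hroot
  obtain ⟨α, hα, β, hβ, hαβ⟩ := hdiff h hh
  have hw0 : w = 0 := by
    apply h3 _ w (hmem β hβ v hv)
    convert hmem α hα v' hv' using 1
    rw [← hαβ, ← sub_add_cancel v' v, hw]
    abel
  rw [hw, hw0]
  simpa using hh

lemma mem_of_rootsA2 {S : Set (ℤ × ℤ)}
    (h8 : ∀ x e f g : ℤ × ℤ, e ≠ 0 → f ≠ 0 → g ≠ 0 →
      ¬ ∀ y ∈ [0, e], ∀ z ∈ [0, f], ∀ w ∈ [0, g], x + (y + z + w) ∈ S) {o c d : ℤ × ℤ}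
    (hdet : c.1 * d.2 - c.2 * d.1 = 1)
    (hmem : ∀ u ∈ [(0 : ℤ × ℤ), (1, 0), (0, 1)], ∀ v ∈ [0, c, d], o + (u + v) ∈ S)
    (hc : c ∈ rootsA2) (hd : d ∈ rootsA2) :
    (c, d) ∈ [(((1, 0), (0, 1)) : (ℤ × ℤ) × (ℤ × ℤ)), ((-1, 1), (-1, 0)),
      ((0, -1), (1, -1))] := by
  refine (exists_cube_in_vertexSums c hc d hd hdet).resolve_right ?_
  rintro ⟨x, -, e, he, f, hf, g, hg, hx⟩
  have hne : ∀ e ∈ rootsA2, e ≠ 0 := by decide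
  have hsum : ∀ s ∈ vertexSums c d, o + s ∈ S := by
    intro s hs
    simp only [vertexSums, List.mem_cons, List.not_mem_nil, or_false] at hs
    simp only [List.forall_mem_cons, List.not_mem_nil, add_zero, zero_add] at hmem
    rcases hs with rfl | rfl | rfl | rfl | rfl | rfl | rfl | rfl | rfl <;> simp [hmem]
  refine h8 (o + x) e f g (hne e he) (hne f hf) (hne g hg) fun y hy z hz w hw ↦ ?_
  rw [add_assoc]
  exact hsum _ (hx y hy z hz w hw)

lemma mem_of_unimodular {S : Set (ℤ × ℤ)}
    (h3 : ∀ x w : ℤ × ℤ, x ∈ S → x + (3 : ℤ) • w ∈ S → w = 0)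
    (h8 : ∀ x e f g : ℤ × ℤ, e ≠ 0 → f ≠ 0 → g ≠ 0 →
      ¬ ∀ y ∈ [0, e], ∀ z ∈ [0, f], ∀ w ∈ [0, g], x + (y + z + w) ∈ S) {o c d : ℤ × ℤ}
    (hdet : c.1 * d.2 - c.2 * d.1 = 1)
    (hmem : ∀ u ∈ [(0 : ℤ × ℤ), (1, 0), (0, 1)], ∀ v ∈ [0, c, d], o + (u + v) ∈ S) :
    (c, d) ∈ [(((1, 0), (0, 1)) : (ℤ × ℤ) × (ℤ × ℤ)), ((-1, 1), (-1, 0)),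
      ((0, -1), (1, -1))] := by
  have root := @sub_mem_rootsA2 S h3 o c d hmem
  by_cases hc : 3 ∣ c.1 - c.2
  · have hd : ¬ 3 ∣ d.1 - d.2 := by
      intro hd
      obtain ⟨s, hs⟩ := hc
      obtain ⟨t, ht⟩ := hd
      have : (3 : ℤ) ∣ 1 :=
        ⟨s * d.2 - t * c.2, by linear_combination -hdet + d.2 * hs - c.2 * ht⟩
      lia
    have h1 : 0 - d ∈ rootsA2 := root (by simp) (by simp) (by simp; lia)
    have h2 : c - d ∈ rootsA2 := root (by simp) (by simp) (by simp; lia)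
    have := mem_of_rootsA2 h8 (o := o + d) (c := 0 - d) (d := c - d)
      (by simp only [Prod.fst_sub, Prod.snd_sub, Prod.fst_zero, Prod.snd_zero]; linarith) ?_ h1 h2
    · simp only [List.mem_cons, List.not_mem_nil, or_false, Prod.ext_iff, Prod.fst_sub,
        Prod.snd_sub, Prod.fst_zero, Prod.snd_zero] at this ⊢
      lia
    · intro u hu v hv
      have : d + v ∈ [0, c, d] := by
        simp only [List.mem_cons, List.not_mem_nil, or_false] at hv ⊢
        rcases hv with rfl | rfl | rfl <;> simp
      convert hmem u hu _ this using 1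
      abel
  by_cases hd : 3 ∣ (d - c).1 - (d - c).2
  · have h1 : c - 0 ∈ rootsA2 := root (by simp) (by simp) (by simpa)
    have h2 : d - 0 ∈ rootsA2 := root (by simp) (by simp) (by simp at hd ⊢; lia)
    exact mem_of_rootsA2 h8 hdet hmem (by simpa using h1) (by simpa using h2)
  · have h1 : d - c ∈ rootsA2 := root (by simp) (by simp) hd
    have h2 : 0 - c ∈ rootsA2 := root (by simp) (by simp) (by simp; lia)
    have := mem_of_rootsA2 h8 (o := o + c) (c := d - c) (d := 0 - c)
      (by simp only [Prod.fst_sub, Prod.snd_sub, Prod.fst_zero, Prod.snd_zero]; linarith) ?_ h1 h2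
    · simp only [List.mem_cons, List.not_mem_nil, or_false, Prod.ext_iff, Prod.fst_sub,
        Prod.snd_sub, Prod.fst_zero, Prod.snd_zero] at this ⊢
      lia
    · intro u hu v hv
      have : c + v ∈ [0, c, d] := by
        simp only [List.mem_cons, List.not_mem_nil, or_false] at hv ⊢
        rcases hv with rfl | rfl | rfl <;> simp
      convert hmem u hu _ this using 1
      abel

lemma eq_combination {a b : Fin 2 → ℤ} (hab : cross a b = 1) (v : Fin 2 → ℤ) :
    v = cross v b • a + cross a v • b := by
  have h0 : v 0 = (a 0 * b 1 - a 1 * b 0) * v 0 := by rw [← cross, hab, one_mul]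
  have h1 : v 1 = (a 0 * b 1 - a 1 * b 0) * v 1 := by rw [← cross, hab, one_mul]
  funext i
  fin_cases i <;> simp [cross] <;> linarith

/-- Two positively oriented unimodular triangles whose Minkowski sum contains no sum of three
lattice segments have the same edge vectors. -/
lemma eq_of_unimodular {P : Set (Fin 2 → ℝ)} (hP : Convex ℝ P) (hP3 : ¬ IsDecomp P 3)
    {o a b c d : Fin 2 → ℤ} (hab : cross a b = 1) (hcd : cross c d = 1)
    (hmem : ∀ u ∈ [0, a, b], ∀ v ∈ [0, c, d], coeV (o + (u + v)) ∈ P) :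
    (c = a ∧ d = b) ∨ (c = b - a ∧ d = -a) ∨ (c = -b ∧ d = a - b) := by
  let φ : ℤ × ℤ → Fin 2 → ℤ := fun z ↦ z.1 • a + z.2 • b
  have hadd (z w) : φ (z + w) = φ z + φ w := by
    simp only [φ, Prod.fst_add, Prod.snd_add]
    module
  have hsmul (w) : φ ((3 : ℤ) • w) = (3 : ℤ) • φ w := by
    simp only [φ, Prod.smul_fst, Prod.smul_snd, smul_eq_mul]
    module
  have h0 : φ 0 = 0 := by simp [φ]
  have hinj (z) (hz : φ z = 0) : z = 0 := by
    have e0 := congrFun hz 0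
    have e1 := congrFun hz 1
    simp only [φ, Pi.add_apply, Pi.smul_apply, smul_eq_mul, Pi.zero_apply] at e0 e1
    simp only [cross] at hab
    exact Prod.ext (by simp only [Prod.fst_zero]; linear_combination b 1 * e0 - b 0 * e1 - z.1 * hab)
      (by simp only [Prod.snd_zero]; linear_combination a 0 * e1 - a 1 * e0 - z.2 * hab)
  have hφc : φ (cross c b, cross a c) = c := (eq_combination hab c).symm
  have hφd : φ (cross d b, cross a d) = d := (eq_combination hab d).symm
  have hφa : φ (1, 0) = a := by simp [φ]
  have hφb : φ (0, 1) = b := by simp [φ]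
  have hlift (e : ℤ × ℤ) : ∀ y ∈ ({0, φ e} : Set (Fin 2 → ℤ)), ∃ y' ∈ [0, e], φ y' = y := by
    rintro y (rfl | rfl)
    · exact ⟨0, by simp, h0⟩
    · exact ⟨e, by simp, rfl⟩
  have key := mem_of_unimodular (S := {z | coeV (o + φ z) ∈ P}) (o := 0)
    (c := (cross c b, cross a c)) (d := (cross d b, cross a d)) ?_ ?_ ?_ ?_
  · simp only [List.mem_cons, List.not_mem_nil, or_false, Prod.mk.injEq] at key
    rw [← hφc, ← hφd]
    rcases key with ⟨⟨h1, h2⟩, h3, h4⟩ | ⟨⟨h1, h2⟩, h3, h4⟩ | ⟨⟨h1, h2⟩, h3, h4⟩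
    · exact Or.inl (by simp [φ, h1, h2, h3, h4])
    · refine Or.inr (Or.inl ?_)
      rw [h1, h2, h3, h4]
      exact ⟨by simp only [φ]; module, by simp only [φ]; module⟩
    · refine Or.inr (Or.inr ?_)
      rw [h1, h2, h3, h4]
      exact ⟨by simp only [φ]; module, by simp only [φ]; module⟩
  · intro x w hx hw
    by_contra hne
    refine hP3 (isDecomp_three_of_three_smul hP (fun h ↦ hne (hinj w h)) hx ?_)
    simpa only [Set.mem_ofPred_eq, hadd, hsmul, add_assoc] using hw
  · intro x e f g he hf hg h
    refine hP3 (isDecomp_three_of_mem hP (x := o + φ x) (fun h ↦ he (hinj e h))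
      (fun h ↦ hf (hinj f h)) (fun h ↦ hg (hinj g h)) ?_)
    intro y hy z hz w hw
    obtain ⟨y', hy', rfl⟩ := hlift _ y hy
    obtain ⟨z', hz', rfl⟩ := hlift _ z hz
    obtain ⟨w', hw', rfl⟩ := hlift _ w hw
    have hmem' := h y' hy' z' hz' w' hw'
    rw [Set.mem_ofPred_eq, hadd, hadd, hadd] at hmem'
    rwa [add_assoc]
  · have : cross c b * cross a d - cross a c * cross d b = cross a b * cross c d := by
      simp only [cross]
      ring
    simp only [this, hab, hcd, mul_one]
  · intro u hu v hv
    rw [zero_add, Set.mem_ofPred_eq, hadd]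
    apply hmem
    · simp only [List.mem_cons, List.not_mem_nil, or_false] at hu ⊢
      rcases hu with rfl | rfl | rfl <;> simp [h0, hφa, hφb]
    · simp only [List.mem_cons, List.not_mem_nil, or_false] at hv ⊢
      rcases hv with rfl | rfl | rfl <;> simp [h0, hφc, hφd]

/-- A convex set containing a lattice segment and a lattice point to its left contains a
lattice point at lattice distance one to its left. -/
lemma exists_cross_eq_one_of_pos {Q : Set (Fin 2 → ℝ)} (hQ : Convex ℝ Q)
    {u a r v : Fin 2 → ℤ} (har : cross a r = 1) (hu : coeV u ∈ Q) (ha : coeV (u + a) ∈ Q)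
    (hv : coeV (u + v) ∈ Q) (hpos : 0 < cross a v) :
    ∃ b, cross a b = 1 ∧ coeV (u + b) ∈ Q := by
  have hcomb := eq_combination har v
  set m := cross a v
  set x := cross v r
  have h1 := Int.emod_nonneg (-x) hpos.ne'
  have h2 := Int.emod_lt_of_pos (-x) hpos
  have h3 := Int.emod_add_mul_ediv (-x) m
  set s := (-x) % m
  set t := (-x) / m
  refine ⟨r - t • a, ?_, ?_⟩
  · simp only [cross, Pi.sub_apply, Pi.smul_apply, smul_eq_mul] at har ⊢
    linarith
  · refine hQ.coeV_mem hu ha hv (α := m - 1 - s) (β := s) (γ := 1)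
      (by lia) h1 zero_le_one (by lia) ?_
    rw [hcomb, show x = -(s + m * t) by lia]
    module

/-- The triangle with vertices `u`, `u + a`, `u + b` is positively oriented and unimodular,
and its vertices lie in `Q`. -/
def HasUnimodular (Q : Set (Fin 2 → ℝ)) (u a b : Fin 2 → ℤ) : Prop :=
  cross a b = 1 ∧ coeV u ∈ Q ∧ coeV (u + a) ∈ Q ∧ coeV (u + b) ∈ Q

lemma HasUnimodular.rotate {Q : Set (Fin 2 → ℝ)} {u a b : Fin 2 → ℤ}
    (h : HasUnimodular Q u a b) : HasUnimodular Q (u + a) (b - a) (-a) := by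
  obtain ⟨h1, h2, h3, h4⟩ := h
  refine ⟨?_, h3, by simpa using h4, by simpa using h2⟩
  simp only [cross, Pi.sub_apply, Pi.neg_apply] at h1 ⊢
  linarith

lemma HasUnimodular.add_mem {Q₁ Q₂ : Set (Fin 2 → ℝ)} {u a b w c d : Fin 2 → ℤ}
    (h₁ : HasUnimodular Q₁ u a b) (h₂ : HasUnimodular Q₂ w c d) :
    ∀ x ∈ [0, a, b], ∀ y ∈ [0, c, d], coeV (u + w + (x + y)) ∈ Q₁ + Q₂ := by
  intro x hx y hy
  rw [add_add_add_comm, coeV_add]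
  simp only [List.mem_cons, List.not_mem_nil, or_false] at hx hy
  obtain ⟨-, h1, h2, h3⟩ := h₁
  obtain ⟨-, k1, k2, k3⟩ := h₂
  refine Set.add_mem_add ?_ ?_
  · rcases hx with rfl | rfl | rfl <;> simpa
  · rcases hy with rfl | rfl | rfl <;> simpa

/-- No lattice point of `Q₁` lies strictly to the right of the edge `a`. -/
lemma HasUnimodular.cross_nonneg {Q₁ Q₂ : Set (Fin 2 → ℝ)} (hQ₁ : Convex ℝ Q₁)
    (hQ₂ : Convex ℝ Q₂) (h3 : ¬ IsDecomp (Q₁ + Q₂) 3) {u a b w c d v : Fin 2 → ℤ}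
    (h₁ : HasUnimodular Q₁ u a b) (h₂ : HasUnimodular Q₂ w c d) (hv : coeV (u + v) ∈ Q₁) :
    0 ≤ cross a v := by
  by_contra! hneg
  have h₁' := h₁
  obtain ⟨hab, h1, h2, -⟩ := h₁'
  obtain ⟨r, hr, hr'⟩ := exists_cross_eq_one_of_pos hQ₁ (u := u + a) (a := -a) (r := -b)
    (v := v - a) (by simpa [cross] using hab) h2 (by simpa using h1) (by simpa using hv)
    (by simp only [cross, Pi.neg_apply, Pi.sub_apply] at hneg ⊢; linarith)
  have h₁'' : HasUnimodular Q₁ (u + a) (-a) r := ⟨hr, h2, by simpa using h1, hr'⟩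
  have e1 := eq_of_unimodular (hQ₁.add hQ₂) h3 hab h₂.1 (h₁.add_mem h₂)
  have e2 := eq_of_unimodular (hQ₁.add hQ₂) h3 hr h₂.1 (h₁''.add_mem h₂)
  simp only [funext_iff, Fin.forall_fin_two, Pi.neg_apply, Pi.sub_apply] at e1 e2
  have hne : ¬ (a 0 = 0 ∧ a 1 = 0) := by
    rintro ⟨h, h'⟩
    simp [cross, h, h'] at hab
  have hne' : ¬ (b 0 = 0 ∧ b 1 = 0) := by
    rintro ⟨h, h'⟩
    simp [cross, h, h'] at hab
  have hne'' : ¬ (a 0 = b 0 ∧ a 1 = b 1) := by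
    rintro ⟨h, h'⟩
    simp [cross, h, h', mul_comm] at hab
  lia

lemma HasUnimodular.eq_convexHull {Q₁ Q₂ : Set (Fin 2 → ℝ)} (hQ₁ : IsLatticeTriangle Q₁)
    (hQ₂ : Convex ℝ Q₂) (h3 : ¬ IsDecomp (Q₁ + Q₂) 3) {u a b w c d : Fin 2 → ℤ}
    (h₁ : HasUnimodular Q₁ u a b) (h₂ : HasUnimodular Q₂ w c d) :
    Q₁ = convexHull ℝ {coeV u, coeV (u + a), coeV (u + b)} := by
  have hconv : Convex ℝ Q₁ := by
    obtain ⟨p, q, r, -, rfl⟩ := hQ₁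
    exact convex_convexHull ..
  have hpt (v) (hv : coeV v ∈ Q₁) :
      coeV v ∈ convexHull ℝ {coeV u, coeV (u + a), coeV (u + b)} := by
    have k1 := h₁.cross_nonneg hconv hQ₂ h3 h₂ (v := v - u) (by simpa)
    have k2 := h₁.rotate.cross_nonneg hconv hQ₂ h3 h₂ (v := v - (u + a)) (by simpa)
    have k3 := h₁.rotate.rotate.cross_nonneg hconv hQ₂ h3 h₂
      (v := v - (u + a + (b - a))) (by simpa)
    have hab := h₁.1
    have hcomb := eq_combination hab (v - u)
    have e2 : cross (b - a) (v - (u + a)) = 1 - cross a (v - u) - cross (v - u) b := by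
      rw [← hab]
      simp only [cross, Pi.sub_apply, Pi.add_apply]
      ring
    have e3 : cross (-a - (b - a)) (v - (u + a + (b - a))) = cross (v - u) b := by
      simp only [cross, Pi.sub_apply, Pi.add_apply, Pi.neg_apply]
      ring
    refine (convex_convexHull ℝ _).coeV_mem (p := u) (q := u + a) (r := u + b)
      (subset_convexHull _ _ (by simp)) (subset_convexHull _ _ (by simp))
      (subset_convexHull _ _ (by simp)) (e2 ▸ k2) (e3 ▸ k3) k1 (by lia) ?_
    have hv : v = u + (cross (v - u) b • a + cross a (v - u) • b) := by
      rw [← hcomb]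
      abel
    generalize cross (v - u) b = s at hv
    generalize cross a (v - u) = t at hv
    rw [hv]
    module
  apply subset_antisymm
  · obtain ⟨p, q, r, -, rfl⟩ := hQ₁
    refine convexHull_min ?_ (convex_convexHull ..)
    rintro _ (rfl | rfl | rfl) <;> exact hpt _ (subset_convexHull _ _ (by simp))
  · refine convexHull_min ?_ hconv
    rintro _ (rfl | rfl | rfl)
    exacts [h₁.2.1, h₁.2.2.1, h₁.2.2.2]

lemma cross_ne_zero_of_affineIndependent {p q r : Fin 2 → ℤ}
    (h : AffineIndependent ℝ ![coeV p, coeV q, coeV r]) : cross (q - p) (r - p) ≠ 0 := by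
  intro h0
  have h0' : ((q 0 : ℝ) - p 0) * (r 1 - p 1) - (q 1 - p 1) * (r 0 - p 0) = 0 := by
    exact_mod_cast h0
  rw [affineIndependent_iff] at h
  have key (x y : ℝ) (h1 : x * ((q 0 : ℝ) - p 0) + y * (r 0 - p 0) = 0)
      (h2 : x * ((q 1 : ℝ) - p 1) + y * (r 1 - p 1) = 0) : x = 0 ∧ y = 0 := by
    have := h Finset.univ ![-x - y, x, y] (by simp [Fin.sum_univ_three]; ring) ?_
    · exact ⟨by simpa using this 1, by simpa using this 2⟩
    · rw [Fin.sum_univ_three]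
      funext i
      fin_cases i <;> simp [coeV] <;> linarith
  obtain ⟨a1, b1⟩ := key (r 0 - p 0) (-(q 0 - p 0)) (by ring) (by linarith)
  obtain ⟨a2, b2⟩ := key (r 1 - p 1) (-(q 1 - p 1)) (by linarith) (by ring)
  have := key 1 0 (by linarith) (by linarith)
  exact one_ne_zero this.1

lemma IsLatticeTriangle.exists_hasUnimodular {Q : Set (Fin 2 → ℝ)} (hQ : IsLatticeTriangle Q) :
    ∃ u a b, HasUnimodular Q u a b := by
  obtain ⟨p, q, r, hind, rfl⟩ := hQ
  have hdet := cross_ne_zero_of_affineIndependent hind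
  have hconv := convex_convexHull ℝ {coeV p, coeV q, coeV r}
  have hp : coeV p ∈ convexHull ℝ {coeV p, coeV q, coeV r} := subset_convexHull _ _ (by simp)
  have hq : coeV q ∈ convexHull ℝ {coeV p, coeV q, coeV r} := subset_convexHull _ _ (by simp)
  have hr : coeV r ∈ convexHull ℝ {coeV p, coeV q, coeV r} := subset_convexHull _ _ (by simp)
  generalize convexHull ℝ {coeV p, coeV q, coeV r} = Q at *
  wlog hpos : 0 < cross (q - p) (r - p) generalizing q r
  · have hswap : cross (r - p) (q - p) = -cross (q - p) (r - p) := by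
      simp only [cross]
      ring
    refine this r q ?_ (by lia) hr hq (by lia)
    have := hind.comp_embedding (Equiv.swap (1 : Fin 3) 2).toEmbedding
    convert this using 1
    funext i
    fin_cases i <;> rfl
  have hne : q - p ≠ 0 := by
    intro h
    exact hdet (by rw [h]; simp [cross])
  obtain ⟨m, a, hm, ha, hma⟩ := exists_primitive_smul hne
  obtain ⟨s, hs⟩ := exists_cross_eq_one ha
  have hpa : coeV (p + a) ∈ Q := by
    refine hconv.coeV_mem hp hp hq (α := m - 1) (β := 0) (γ := 1) (by lia) le_rfl zero_le_one
      (by lia) ?_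
    rw [eq_add_of_sub_eq hma]
    module
  have hcross : cross (q - p) (r - p) = m * cross a (r - p) := by
    rw [hma]
    simp only [cross, Pi.smul_apply, smul_eq_mul]
    ring
  obtain ⟨b, hb, hpb⟩ := exists_cross_eq_one_of_pos hconv (v := r - p) hs hp hpa (by simpa)
    (pos_of_mul_pos_right (hcross ▸ hpos) hm.le)
  exact ⟨p, a, b, hb, hp, hpa, hpb⟩

lemma image_add_convexHull_triple {n : ℕ} (p q r t : Fin n → ℤ) :
    (fun x ↦ x + coeV t) '' convexHull ℝ {coeV p, coeV q, coeV r} =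
      convexHull ℝ {coeV (p + t), coeV (q + t), coeV (r + t)} := by
  have h := (AffineEquiv.vaddConst ℝ (coeV t)).toAffineMap.image_convexHull
    {coeV p, coeV q, coeV r}
  simp only [Set.image_insert_eq, Set.image_singleton] at h
  simp only [coeV_add]
  exact h

/-- If `Q₁` and `Q₂` are lattice triangles of Minkowski length 1 with `L(Q₁ + Q₂) = 2`,
then `Q₂` is a translate of `Q₁`. -/
theorem stmt16 (Q₁ Q₂ : Set (Fin 2 → ℝ))
    (h1 : IsLatticeTriangle Q₁) (h2 : IsLatticeTriangle Q₂)
    (hL1 : MinkLen Q₁ 1) (hL2 : MinkLen Q₂ 1) (hsum : MinkLen (Q₁ + Q₂) 2) :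
    ∃ t : Fin 2 → ℤ, Q₂ = (fun x => x + coeV t) '' Q₁ := by
  have h3 : ¬ IsDecomp (Q₁ + Q₂) 3 := fun h ↦ absurd (hsum.2 3 h) (by norm_num)
  have h3' : ¬ IsDecomp (Q₂ + Q₁) 3 := by rwa [add_comm]
  obtain ⟨u, a, b, hu⟩ := h1.exists_hasUnimodular
  obtain ⟨w, c, d, hw⟩ := h2.exists_hasUnimodular
  have hconv : ∀ Q, IsLatticeTriangle Q → Convex ℝ Q := by
    rintro _ ⟨p, q, r, -, rfl⟩
    exact convex_convexHull ..
  have e1 := hu.eq_convexHull h1 (hconv _ h2) h3 hw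
  have e2 := hw.eq_convexHull h2 (hconv _ h1) h3' hu
  have hcases := eq_of_unimodular ((hconv _ h1).add (hconv _ h2)) h3 hu.1 hw.1 (hu.add_mem hw)
  simp only [e1, e2, image_add_convexHull_triple]
  rcases hcases with ⟨rfl, rfl⟩ | ⟨rfl, rfl⟩ | ⟨rfl, rfl⟩
  · refine ⟨w - u, ?_⟩
    rw [show u + (w - u) = w by abel, show u + c + (w - u) = w + c by abel,
      show u + d + (w - u) = w + d by abel]
  · refine ⟨w - a - u, ?_⟩
    rw [show u + (w - a - u) = w + -a by abel, show u + a + (w - a - u) = w by abel,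
      show u + b + (w - a - u) = w + (b - a) by abel, Set.insert_comm (coeV (w + -a)),
      Set.pair_comm (coeV (w + -a))]
  · refine ⟨w - b - u, ?_⟩
    rw [show u + (w - b - u) = w + -b by abel, show u + a + (w - b - u) = w + (a - b) by abel,
      show u + b + (w - b - u) = w by abel, Set.pair_comm (coeV (w + (a - b))),
      Set.insert_comm (coeV (w + -b))]
end
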